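/- arXiv:2305.08617 — 2 statements merged into one kernel-verified Lean document; each statement's English description precedes it below -/
import Mathlib

section
/- Let X = G⟨c⟩ where G = ⟨a,b⟩ is a dihedral or generalized quaternion 2-group (order ≥ 8), ⟨c⟩ is cyclic with G ∩ ⟨c⟩ = 1, the product ⟨a⟩⟨c⟩ is a subgroup of X, and the core of ⟨c⟩ in X is trivial. If G is a 2-group then ⟨a^2⟩ is normal in X. -/
open scoped Pointwise
open scoped commutatorElement

/-- A subgroup `M` such that `M ∪ bM` is the whole group is normal. -/
theorem Subgroup.normal_of_mem_or_inv_mul_mem {X : Type*} [Group X] {M : Subgroup X} {b : X}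
    (h : ∀ x, x ∈ M ∨ b⁻¹ * x ∈ M) : M.Normal := by
  have key : ∀ m ∈ M, b * m * b⁻¹ ∈ M := by
    intro m hm
    rcases h (b * m * b⁻¹) with h1 | h1
    · exact h1
    · have h2 : b⁻¹ ∈ M := by
        have := M.mul_mem (M.inv_mem hm) h1
        simpa [mul_assoc] using this
      exact M.mul_mem (M.mul_mem (by simpa using h2) hm) h2
  refine ⟨fun m hm x => ?_⟩
  rcases h x with hx | hx
  · exact M.mul_mem (M.mul_mem hx hm) (M.inv_mem hx)
  · have := key _ (M.mul_mem (M.mul_mem hx hm) (M.inv_mem hx))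
    simpa [mul_assoc] using this

/-- If a group is `M ∪ bM` with `M = ⟨a⟩⟨c⟩`, normality of a subgroup can be tested on
`a`, `b`, `c`. -/
theorem Subgroup.normal_of_mem_normalizer {X : Type*} [Group X] {M Q : Subgroup X} {a b c : X}
    (hM : ∀ x, x ∈ M ↔ ∃ i j : ℤ, x = a ^ i * c ^ j) (hX : ∀ x, x ∈ M ∨ b⁻¹ * x ∈ M)
    (ha : a ∈ Subgroup.normalizer (Q : Set X)) (hb : b ∈ Subgroup.normalizer (Q : Set X))
    (hc : c ∈ Subgroup.normalizer (Q : Set X)) : Q.Normal := by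
  rw [← Subgroup.normalizer_eq_top_iff, Subgroup.eq_top_iff']
  have hMle : ∀ x ∈ M, x ∈ Subgroup.normalizer (Q : Set X) := by
    intro x hx
    obtain ⟨i, j, rfl⟩ := (hM x).1 hx
    exact mul_mem (zpow_mem ha i) (zpow_mem hc j)
  intro x
  rcases hX x with hx | hx
  · exact hMle x hx
  · have := mul_mem hb (hMle _ hx)
    simpa using this

/-- In a group in which a core-free subgroup `C` has 2-power index, a commutative normal
subgroup has no nontrivial elements of odd order. -/
theorem Subgroup.eq_one_of_odd_orderOf {X : Type*} [Group X] [Finite X] {C V : Subgroup X}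
    (hC : ∃ k, C.index = 2 ^ k) (hcore : C.normalCore = ⊥) (hV : V.Normal)
    (hcomm : ∀ x ∈ V, ∀ y ∈ V, x * y = y * x) {r : X} (hr : r ∈ V) (hodd : Odd (orderOf r)) :
    r = 1 := by
  let R : Subgroup X :=
    { carrier := {x | x ∈ V ∧ Odd (orderOf x)}
      one_mem' := ⟨V.one_mem, by simp⟩
      mul_mem' := by
        rintro x y ⟨hx, hx'⟩ ⟨hy, hy'⟩
        refine ⟨V.mul_mem hx hy, Odd.of_dvd_nat (hx'.mul hy') ?_⟩
        exact Commute.orderOf_mul_dvd_mul_orderOf (hcomm x hx y hy)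
      inv_mem' := by
        rintro x ⟨hx, hx'⟩
        exact ⟨V.inv_mem hx, by simpa using hx'⟩ }
  have hRn : R.Normal := by
    refine ⟨fun x hx g => ⟨hV.conj_mem x hx.1 g, ?_⟩⟩
    have := orderOf_injective (MulAut.conj g).toMonoidHom (MulAut.conj g).injective x
    simp only [MulEquiv.toMonoidHom_eq_coe, MonoidHom.coe_coe, MulAut.conj_apply] at this
    rw [this]
    exact hx.2
  have hRodd : Odd (Nat.card R) := by
    rw [← Nat.not_even_iff_odd, even_iff_two_dvd]
    intro h2
    obtain ⟨x, hx⟩ := exists_prime_orderOf_dvd_card' 2 h2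
    have h3 : Odd (orderOf (x : X)) := x.2.2
    rw [Subgroup.orderOf_coe, hx] at h3
    exact absurd h3 (by decide)
  obtain ⟨k, hk⟩ := hC
  have h1 : C.relIndex R = 1 := by
    have hsup : C.relIndex (C ⊔ R) = C.relIndex R := by
      have e1 := Subgroup.relIndex_mul_relIndex (C ⊓ R) R (C ⊔ R) inf_le_right le_sup_right
      have e2 := Subgroup.relIndex_mul_relIndex (C ⊓ R) C (C ⊔ R) inf_le_left le_sup_left
      rw [Subgroup.relIndex_sup_right, Subgroup.inf_relIndex_right] at e1
      rw [Subgroup.inf_relIndex_left] at e2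
      have hpos : 0 < R.relIndex C :=
        Nat.pos_of_dvd_of_pos (Subgroup.relIndex_dvd_card R C) Nat.card_pos
      have : R.relIndex C * C.relIndex (C ⊔ R) = R.relIndex C * C.relIndex R := by
        rw [e2, ← e1, mul_comm]
      exact Nat.eq_of_mul_eq_mul_left hpos this
    have hd : C.relIndex R ∣ 2 ^ k := by
      rw [← hk, ← hsup]
      exact ⟨_, (Subgroup.relIndex_mul_index le_sup_left).symm⟩
    have hd' : Odd (C.relIndex R) := Odd.of_dvd_nat hRodd (Subgroup.relIndex_dvd_card C R)
    exact Nat.Coprime.eq_one_of_dvd (Nat.Coprime.pow_right k hd'.coprime_two_right) hd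
  have hle : R ≤ C.normalCore :=
    Subgroup.normal_le_normalCore.2 (Subgroup.relIndex_eq_one.1 h1)
  rw [hcore] at hle
  exact Subgroup.mem_bot.1 (hle ⟨hr, hodd⟩)

/-- Conjugating a commutator of `x` and `y` by an element commuting with `y`. -/
theorem conj_commutatorElement_left {X : Type*} [Group X] {x y y₁ x₂ y₂ : X}
    (h : y₁ * x = x₂ * y₂) (h₁ : y * y₁ = y₁ * y) (h₂ : y * y₂ = y₂ * y) :
    y₁ * ⁅x, y⁆ * y₁⁻¹ = ⁅x₂, y⁆ := by
  have hx : x = y₁⁻¹ * x₂ * y₂ := by rw [mul_assoc, ← h]; group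
  have h₁' : y⁻¹ * y₁⁻¹ = y₁⁻¹ * y⁻¹ := by rw [← mul_inv_rev, ← h₁, mul_inv_rev]
  calc y₁ * ⁅x, y⁆ * y₁⁻¹ = (y₁ * x) * y * x⁻¹ * (y⁻¹ * y₁⁻¹) := by
        rw [commutatorElement_def]; group
    _ = (y₁ * x) * y * (y₁ * x)⁻¹ * y⁻¹ := by rw [h₁']; group
    _ = x₂ * (y₂ * y) * y₂⁻¹ * x₂⁻¹ * y⁻¹ := by rw [h]; group
    _ = ⁅x₂, y⁆ := by rw [← h₂, commutatorElement_def]; group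

/-- Conjugating a commutator of `x` and `y` by an element commuting with `x`. -/
theorem conj_commutatorElement_right {X : Type*} [Group X] {x y x₁ x₂ y₂ : X}
    (h : x₁ * y = y₂ * x₂) (h₁ : x * x₁ = x₁ * x) (h₂ : x * x₂ = x₂ * x) :
    x₁ * ⁅x, y⁆ * x₁⁻¹ = ⁅x, y₂⁆ := by
  have := congrArg (·⁻¹) (conj_commutatorElement_left h h₁ h₂)
  simpa [mul_assoc, commutatorElement_inv] using this

/-- The main step in the theorem of Itô on products of abelian groups: if `A` and `C`
are commutative subgroups with `AC = CA`, then the commutators of elements of `A` with elements of `C` commute. -/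
theorem commutatorElement_mul_comm_of_permutable {X : Type*} [Group X] {A C : Subgroup X}
    (hA : ∀ x ∈ A, ∀ y ∈ A, x * y = y * x) (hC : ∀ x ∈ C, ∀ y ∈ C, x * y = y * x)
    (hCA : ∀ x ∈ A, ∀ y ∈ C, ∃ x' ∈ A, ∃ y' ∈ C, y * x = x' * y')
    (hAC : ∀ x ∈ A, ∀ y ∈ C, ∃ y' ∈ C, ∃ x' ∈ A, x * y = y' * x')
    {x x₁ y y₁ : X} (hx : x ∈ A) (hx₁ : x₁ ∈ A) (hy : y ∈ C) (hy₁ : y₁ ∈ C) :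
    ⁅x, y⁆ * ⁅x₁, y₁⁆ = ⁅x₁, y₁⁆ * ⁅x, y⁆ := by
  obtain ⟨x₂, hx₂, y₂, hy₂, h2⟩ := hCA x hx y₁⁻¹ (C.inv_mem hy₁)
  obtain ⟨y₃, hy₃, x₃, hx₃, h3⟩ := hAC x₁⁻¹ (A.inv_mem hx₁) y hy
  have l1 : ∀ t ∈ C, y₁⁻¹ * ⁅x, t⁆ * y₁⁻¹⁻¹ = ⁅x₂, t⁆ := fun t ht =>
    conj_commutatorElement_left h2 (hC _ ht _ (C.inv_mem hy₁)) (hC _ ht _ hy₂)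
  have l2 : ∀ s ∈ A, x₁⁻¹ * ⁅s, y⁆ * x₁⁻¹⁻¹ = ⁅s, y₃⁆ := fun s hs =>
    conj_commutatorElement_right h3 (hA _ hs _ (A.inv_mem hx₁)) (hA _ hs _ hx₃)
  have e : x₁⁻¹ * (y₁⁻¹ * ⁅x, y⁆ * y₁⁻¹⁻¹) * x₁⁻¹⁻¹ =
      y₁⁻¹ * (x₁⁻¹ * ⁅x, y⁆ * x₁⁻¹⁻¹) * y₁⁻¹⁻¹ := by
    rw [l1 y hy, l2 x₂ hx₂, l2 x hx, l1 y₃ hy₃]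
  generalize ⁅x, y⁆ = g at e
  symm
  calc ⁅x₁, y₁⁆ * g
      = x₁ * y₁ * (x₁⁻¹ * (y₁⁻¹ * g * y₁⁻¹⁻¹) * x₁⁻¹⁻¹) * x₁⁻¹ * y₁⁻¹ := by
        rw [commutatorElement_def]; group
    _ = g * ⁅x₁, y₁⁆ := by rw [e, commutatorElement_def]; group

/-- The cyclic group generated by a nontrivial element of 2-power order has an involution that
lies in each of its nontrivial subgroups. -/
theorem exists_involution_of_pow_two_pow_eq_one {X : Type*} [Group X] {g : X}
    (hg : ∃ k : ℕ, g ^ 2 ^ k = 1) (h1 : g ≠ 1) :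
    ∃ z ∈ Subgroup.zpowers g, z ≠ 1 ∧ z ^ 2 = 1 ∧
      ∀ y ∈ Subgroup.zpowers g, y ≠ 1 → z ∈ Subgroup.zpowers y := by
  have two_pow : ∀ y : X, (∃ k : ℕ, y ^ 2 ^ k = 1) → y ≠ 1 →
      ∃ j : ℕ, orderOf y = 2 ^ (j + 1) := by
    rintro y ⟨k, hk⟩ hy
    obtain ⟨j, -, hj⟩ := (Nat.dvd_prime_pow Nat.prime_two).1 (orderOf_dvd_of_pow_eq_one hk)
    rcases j with _ | j
    · exact absurd (orderOf_eq_one_iff.1 (by simpa using hj)) hy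
    · exact ⟨j, hj⟩
  obtain ⟨n, hn⟩ := two_pow g hg h1
  have hz2 : (g ^ 2 ^ n) ^ 2 = 1 := by rw [← pow_mul, ← pow_succ, ← hn, pow_orderOf_eq_one]
  refine ⟨g ^ 2 ^ n, ⟨(2 ^ n : ℕ), by simp only [zpow_natCast]⟩, ?_, hz2, ?_⟩
  · intro h
    have := Nat.le_of_dvd (by positivity) (orderOf_dvd_of_pow_eq_one h)
    rw [hn, pow_succ] at this
    have : 0 < 2 ^ n := by positivity
    omega
  · rintro y ⟨i, rfl⟩ hy
    simp only at hy ⊢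
    obtain ⟨k, hk⟩ := hg
    obtain ⟨j, hj⟩ := two_pow (g ^ i) ⟨k, by rw [← zpow_natCast, zpow_comm, zpow_natCast, hk,
      one_zpow]⟩ hy
    have hw2 : ((g ^ i) ^ 2 ^ j) ^ 2 = 1 := by
      rw [← pow_mul, ← pow_succ, ← hj, pow_orderOf_eq_one]
    have hw1 : (g ^ i) ^ 2 ^ j ≠ 1 := by
      intro h
      have := Nat.le_of_dvd (by positivity) (orderOf_dvd_of_pow_eq_one h)
      rw [hj, pow_succ] at this
      have : 0 < 2 ^ j := by positivity
      omega
    have hexp : (g ^ i) ^ 2 ^ j = g ^ (i * 2 ^ j) := by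
      rw [zpow_mul]; norm_cast
    have hdvd : (2 ^ n : ℤ) ∣ i * 2 ^ j := by
      have : ((orderOf g : ℕ) : ℤ) ∣ (i * 2 ^ j) * 2 := by
        rw [orderOf_dvd_iff_zpow_eq_one, zpow_mul, ← hexp]
        exact_mod_cast hw2
      rw [hn] at this
      push_cast at this
      rw [pow_succ] at this
      exact Int.dvd_of_mul_dvd_mul_right (by norm_num) this
    obtain ⟨r, hr⟩ := hdvd
    have hzr : (g ^ i) ^ 2 ^ j = (g ^ 2 ^ n) ^ r := by
      rw [hexp, hr, zpow_mul]; norm_cast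
    have hz2' : (g ^ 2 ^ n) ^ (2 : ℤ) = 1 := by exact_mod_cast hz2
    rcases Int.even_or_odd' r with ⟨s, rfl | rfl⟩
    · rw [zpow_mul, hz2', one_zpow] at hzr
      exact absurd hzr hw1
    · rw [zpow_add, zpow_mul, hz2', one_zpow, one_mul, zpow_one] at hzr
      exact ⟨(2 ^ j : ℕ), by simpa only [zpow_natCast] using hzr⟩

/-- Some 2-power power of an element of a finite group has odd order. -/
theorem exists_odd_orderOf_pow_two_pow {X : Type*} [Group X] [Finite X] (x : X) :
    ∃ k : ℕ, Odd (orderOf (x ^ 2 ^ k)) := by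
  obtain ⟨k, m, hm, h⟩ := Nat.exists_eq_two_pow_mul_odd (orderOf_pos x).ne'
  refine ⟨k, ?_⟩
  rw [orderOf_pow_of_dvd (by positivity) ⟨m, h⟩, h, Nat.mul_div_cancel_left _ (by positivity)]
  exact hm

/-- Normalizers grow in a finite 2-group. -/
theorem IsPGroup.exists_notMem_conj_mem {X : Type*} [Group X] [Finite X] {S Z : Subgroup X}
    (hS : IsPGroup 2 S) (hZ : ¬ S ≤ Z) :
    ∃ x ∈ S, x ∉ Z ∧ ∀ h ∈ S, h ∈ Z → x * h * x⁻¹ ∈ Z := by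
  have : Group.IsNilpotent S := hS.isNilpotent
  have hlt : Z.subgroupOf S < ⊤ := by
    rw [lt_top_iff_ne_top, Ne, Subgroup.subgroupOf_eq_top]
    exact hZ
  obtain ⟨x, hx, hx'⟩ := SetLike.exists_of_lt (Group.normalizerCondition_of_isNilpotent _ hlt)
  refine ⟨x, x.2, fun h => hx' (Subgroup.mem_subgroupOf.2 h), fun h hS hZ => ?_⟩
  have := (Subgroup.mem_normalizer_iff.1 hx ⟨h, hS⟩).1 (Subgroup.mem_subgroupOf.2 hZ)
  simpa [Subgroup.mem_subgroupOf] using this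

/-- Modulo a subgroup, a cyclic group has at most one involution. -/
theorem mem_or_inv_mul_mem_of_sq_mem {X : Type*} [Group X] {B : Subgroup X} {a y t : X}
    (hy : y ∈ Subgroup.zpowers a) (ht : t ∈ Subgroup.zpowers a) (hyB : y ∉ B)
    (hy2 : y ^ 2 ∈ B) (ht2 : t ^ 2 ∈ B) : t ∈ B ∨ y⁻¹ * t ∈ B := by
  obtain ⟨q, rfl⟩ := hy
  obtain ⟨p, rfl⟩ := ht
  simp only at *
  let H : AddSubgroup ℤ :=
    { carrier := {n | a ^ n ∈ B}
      zero_mem' := by simp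
      add_mem' := by
        intro m n hm hn
        simp only [Set.mem_ofPred_eq, zpow_add] at *
        exact B.mul_mem hm hn
      neg_mem' := by
        intro m hm
        simpa using hm }
  obtain ⟨m, hm⟩ := Int.subgroup_cyclic H
  have mem : ∀ n : ℤ, a ^ n ∈ B ↔ m ∣ n := by
    intro n
    have : a ^ n ∈ B ↔ n ∈ H := Iff.rfl
    rw [this, hm, AddSubgroup.mem_closure_singleton]
    simp only [smul_eq_mul, dvd_iff_exists_eq_mul_left, eq_comm]
  have e : (a ^ q)⁻¹ * a ^ p = a ^ (p - q) := by rw [← zpow_neg, ← zpow_add]; congr 1; ring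
  have sq : ∀ n : ℤ, (a ^ n) ^ 2 = a ^ (2 * n) := fun n => by
    rw [mul_comm, zpow_mul]; norm_cast
  rw [sq, mem] at hy2 ht2
  rw [mem] at hyB
  rw [e, mem, mem]
  obtain ⟨r, hr⟩ := hy2
  obtain ⟨s, hs⟩ := ht2
  rcases Int.even_or_odd' r with ⟨r', rfl | rfl⟩
  · exact absurd ⟨r', by linarith⟩ hyB
  rcases Int.even_or_odd' s with ⟨s', rfl | rfl⟩
  · exact Or.inl ⟨s', by linarith⟩
  · exact Or.inr ⟨s' - r', by linarith⟩

/-- If `dyd⁻¹ = yh` where `h` commutes with `d` and has 2-power order, and `d` has odd order,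
then `d` commutes with `y`. -/
theorem commute_of_conj_eq_mul {X : Type*} [Group X] {d y h : X} (hd : Odd (orderOf d))
    (hh : ∃ k : ℕ, h ^ 2 ^ k = 1) (hdh : d * h = h * d) (e : d * y * d⁻¹ = y * h) :
    d * y = y * d := by
  have key : ∀ n : ℕ, d ^ n * y * (d ^ n)⁻¹ = y * h ^ n := by
    intro n
    induction n with
    | zero => simp
    | succ n ih =>
      have c1 : d * h ^ n * d⁻¹ = h ^ n := by
        rw [(Commute.pow_right hdh n : Commute d (h ^ n)).eq]; group
      calc d ^ (n + 1) * y * (d ^ (n + 1))⁻¹ = d * (d ^ n * y * (d ^ n)⁻¹) * d⁻¹ := by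
            rw [pow_succ']; group
        _ = (d * y * d⁻¹) * (d * h ^ n * d⁻¹) := by rw [ih]; group
        _ = y * h ^ (n + 1) := by rw [e, c1, pow_succ', mul_assoc]
  have h1 : h ^ orderOf d = 1 := by
    have := key (orderOf d)
    rw [pow_orderOf_eq_one] at this
    simpa using this.symm
  obtain ⟨k, hk⟩ := hh
  have h2 : h = 1 := by
    rw [← orderOf_eq_one_iff]
    exact Nat.Coprime.eq_one_of_dvd
      (Nat.Coprime.of_dvd_left (orderOf_dvd_of_pow_eq_one h1)
        (Nat.Coprime.pow_right k hd.coprime_two_right))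
      (orderOf_dvd_of_pow_eq_one hk)
  rw [h2, mul_one] at e
  exact mul_inv_eq_iff_eq_mul.1 e

/-- Let `S = A(S ∩ C)` be a 2-group normalized by an element `d` of odd order that
centralizes `S ∩ C`, where `A = ⟨a⟩`. Then `d` centralizes `S`. -/
theorem IsPGroup.le_centralizer_of_odd_orderOf {X : Type*} [Group X] [Finite X]
    {S : Subgroup X} {a c d : X} (hS : IsPGroup 2 S) (haS : a ∈ S) (hd : Odd (orderOf d))
    (hSn : ∀ s ∈ S, d * s * d⁻¹ ∈ S) (hdc : d * c = c * d)
    (hSM : ∀ s ∈ S, ∃ i j : ℤ, s = a ^ i * c ^ j) :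
    S ≤ Subgroup.centralizer {d} := by
  have memZ : ∀ x, x ∈ Subgroup.centralizer {d} ↔ d * x = x * d := by
    intro x
    rw [Subgroup.mem_centralizer_singleton_iff]
    exact eq_comm
  generalize Subgroup.centralizer {d} = Z at memZ
  by_contra hSZ
  obtain ⟨x, hxS, hxZ, hx⟩ := hS.exists_notMem_conj_mem hSZ
  have hcZ : ∀ j : ℤ, c ^ j ∈ Z := fun j => Z.zpow_mem ((memZ c).2 hdc) j
  have norm_left : ∀ i j : ℤ, a ^ i * c ^ j ∈ S →
      (∀ h ∈ S, h ∈ Z → a ^ i * c ^ j * h * (a ^ i * c ^ j)⁻¹ ∈ Z) →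
      ∀ h ∈ S, h ∈ Z → a ^ i * h * (a ^ i)⁻¹ ∈ Z := by
    intro i j hs hn h hhS hhZ
    have hcS : c ^ j ∈ S := by
      simpa using S.mul_mem (S.inv_mem (S.zpow_mem haS i)) hs
    have := hn ((c ^ j)⁻¹ * h * c ^ j) (S.mul_mem (S.mul_mem (S.inv_mem hcS) hhS) hcS)
      (Z.mul_mem (Z.mul_mem (Z.inv_mem (hcZ j)) hhZ) (hcZ j))
    convert this using 1
    group
  obtain ⟨i, j, rfl⟩ := hSM x hxS
  have hai := norm_left i j hxS hx
  have haiZ : a ^ i ∉ Z := fun h => hxZ (Z.mul_mem h (hcZ j))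
  obtain ⟨y, hyA, hyZ, hy2, hyn⟩ : ∃ y ∈ Subgroup.zpowers a, y ∉ Z ∧ y ^ 2 ∈ Z ∧
      ∀ h ∈ S, h ∈ Z → y * h * y⁻¹ ∈ Z := by
    have hex : ∃ k : ℕ, (a ^ i) ^ 2 ^ k ∈ Z := by
      obtain ⟨k, hk⟩ := hS ⟨a ^ i, S.zpow_mem haS i⟩
      refine ⟨k, ?_⟩
      have : (a ^ i) ^ 2 ^ k = 1 := by simpa using congrArg Subtype.val hk
      rw [this]
      exact Z.one_mem
    classical
    obtain ⟨k, hk⟩ : ∃ k, Nat.find hex = k + 1 := by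
      refine Nat.exists_eq_succ_of_ne_zero fun h0 => haiZ ?_
      have := Nat.find_spec hex
      rw [h0] at this
      simpa using this
    refine ⟨(a ^ i) ^ 2 ^ k, ?_, Nat.find_min hex (by omega), ?_, ?_⟩
    · exact Subgroup.pow_mem _ (Subgroup.zpow_mem _ (Subgroup.mem_zpowers a) i) _
    · have := Nat.find_spec hex
      rw [hk, pow_succ, pow_mul] at this
      exact this
    · have pow_norm : ∀ n : ℕ, ∀ h ∈ S, h ∈ Z → (a ^ i) ^ n * h * ((a ^ i) ^ n)⁻¹ ∈ Z := by
        intro n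
        induction n with
        | zero => intro h _ hZ; simpa using hZ
        | succ n ih =>
          intro h hhS hhZ
          have haS' := S.zpow_mem haS i
          have := ih (a ^ i * h * (a ^ i)⁻¹)
            (S.mul_mem (S.mul_mem haS' hhS) (S.inv_mem haS')) (hai h hhS hhZ)
          convert this using 1
          rw [pow_succ]
          group
      exact pow_norm _
  have hyS : y ∈ S := by
    obtain ⟨q, rfl⟩ := hyA
    exact S.zpow_mem haS q
  have hwS := hSn y hyS
  obtain ⟨p, q, hw⟩ := hSM _ hwS
  have hwn : ∀ h ∈ S, h ∈ Z → a ^ p * c ^ q * h * (a ^ p * c ^ q)⁻¹ ∈ Z := by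
    intro h hhS hhZ
    have hdh : d⁻¹ * h * d = h := by rw [mul_assoc, ← (memZ h).1 hhZ]; group
    have h1 := hyn h hhS hhZ
    have h2 : d * y * d⁻¹ * h * (d * y * d⁻¹)⁻¹ = y * h * y⁻¹ := by
      calc d * y * d⁻¹ * h * (d * y * d⁻¹)⁻¹ = d * (y * (d⁻¹ * h * d) * y⁻¹) * d⁻¹ := by group
        _ = y * h * y⁻¹ := by rw [hdh, (memZ _).1 h1]; group
    rw [← hw, h2]
    exact h1
  have hw' : a ^ p * c ^ q ∈ S := hw ▸ hwS
  have hcS : c ^ q ∈ S := by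
    simpa using S.mul_mem (S.inv_mem (S.zpow_mem haS p)) hw'
  have hapn := norm_left p q hw' hwn
  have hap2 : (a ^ p) ^ 2 ∈ Z := by
    have h1 : (a ^ p * c ^ q) ^ 2 ∈ Z := by
      rw [← hw]
      have : (d * y * d⁻¹) ^ 2 = y ^ 2 := by
        calc (d * y * d⁻¹) ^ 2 = d * y ^ 2 * d⁻¹ := by rw [pow_two, pow_two]; group
          _ = y ^ 2 := by rw [(memZ _).1 hy2]; group
      rw [this]
      exact hy2
    have h2 : a ^ p * c ^ q * (a ^ p)⁻¹ ∈ Z := hapn _ hcS (hcZ q)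
    have h3 : (a ^ p) ^ 2 =
        (a ^ p * c ^ q * (a ^ p)⁻¹)⁻¹ * ((a ^ p * c ^ q) ^ 2 * (c ^ q)⁻¹) := by
      rw [pow_two, pow_two]; group
    rw [h3]
    exact Z.mul_mem (Z.inv_mem h2) (Z.mul_mem h1 (Z.inv_mem (hcZ q)))
  rcases mem_or_inv_mul_mem_of_sq_mem hyA ⟨p, rfl⟩ hyZ hy2 hap2 with h | h
  · apply hyZ
    have h1 : d * y * d⁻¹ ∈ Z := hw ▸ Z.mul_mem h (hcZ q)
    have h2 := Z.mul_mem (Z.mul_mem (Z.inv_mem ((memZ d).2 rfl)) h1) ((memZ d).2 rfl)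
    simpa [mul_assoc] using h2
  · apply hyZ
    have hh : y⁻¹ * a ^ p * c ^ q ∈ Z := Z.mul_mem h (hcZ q)
    have hhS : y⁻¹ * a ^ p * c ^ q ∈ S :=
      S.mul_mem (S.mul_mem (S.inv_mem hyS) (S.zpow_mem haS p)) hcS
    rw [memZ]
    refine commute_of_conj_eq_mul hd ?_ ((memZ _).1 hh) (by rw [hw]; group)
    obtain ⟨k, hk⟩ := hS ⟨_, hhS⟩
    exact ⟨k, by simpa using congrArg Subtype.val hk⟩

/-- The commutator of permutable cyclic groups `⟨a⟩` and `⟨c⟩` is commutative, and normal in a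
group generated by `a`, `b`, `c` in which `b` inverts `a` and `⟨a⟩⟨c⟩` has index at most `2`. -/
theorem commutator_zpowers_normal_and_comm {X : Type*} [Group X] [Finite X] {M : Subgroup X}
    {a b c : X} (hM : ∀ x, x ∈ M ↔ ∃ i j : ℤ, x = a ^ i * c ^ j)
    (hX : ∀ x, x ∈ M ∨ b⁻¹ * x ∈ M) (hrel : b * a * b⁻¹ = a⁻¹) :
    ⁅Subgroup.zpowers a, Subgroup.zpowers c⁆.Normal ∧
      ∀ x ∈ ⁅Subgroup.zpowers a, Subgroup.zpowers c⁆,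
        ∀ y ∈ ⁅Subgroup.zpowers a, Subgroup.zpowers c⁆, x * y = y * x := by
  have hMn : M.Normal := Subgroup.normal_of_mem_or_inv_mul_mem hX
  have zcomm : ∀ g : X, ∀ x ∈ Subgroup.zpowers g, ∀ y ∈ Subgroup.zpowers g, x * y = y * x := by
    rintro g _ ⟨i, rfl⟩ _ ⟨j, rfl⟩
    exact zpow_mul_comm g i j
  have hinv : ∀ i : ℤ, b * a ^ i * b⁻¹ = a ^ (-i) := by
    intro i
    rw [← conj_zpow, hrel, inv_zpow, zpow_neg]
  have hMmem : ∀ x, x ∈ M ↔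
      ∃ x' ∈ Subgroup.zpowers a, ∃ y' ∈ Subgroup.zpowers c, x = x' * y' := by
    intro x
    rw [hM]
    constructor
    · rintro ⟨i, j, h⟩
      exact ⟨_, ⟨i, rfl⟩, _, ⟨j, rfl⟩, h⟩
    · rintro ⟨_, ⟨i, rfl⟩, _, ⟨j, rfl⟩, h⟩
      exact ⟨i, j, h⟩
  have hinvA : ∀ x ∈ Subgroup.zpowers a, b * x * b⁻¹ ∈ Subgroup.zpowers a := by
    rintro _ ⟨i, rfl⟩
    exact ⟨-i, (hinv i).symm⟩
  have haA := Subgroup.mem_zpowers a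
  have hcC := Subgroup.mem_zpowers c
  have hAcomm := zcomm a
  have hCcomm := zcomm c
  generalize Subgroup.zpowers a = A at *
  generalize Subgroup.zpowers c = C at *
  have hAM : A ≤ M := fun x hx => (hMmem x).2 ⟨x, hx, 1, C.one_mem, by simp⟩
  have hCM : C ≤ M := fun x hx => (hMmem x).2 ⟨1, A.one_mem, x, hx, by simp⟩
  have hCA : ∀ x ∈ A, ∀ y ∈ C, ∃ x' ∈ A, ∃ y' ∈ C, y * x = x' * y' := fun x hx y hy =>
    (hMmem _).1 (M.mul_mem (hCM hy) (hAM hx))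
  have hAC : ∀ x ∈ A, ∀ y ∈ C, ∃ y' ∈ C, ∃ x' ∈ A, x * y = y' * x' := by
    intro x hx y hy
    obtain ⟨x', hx', y', hy', h⟩ := hCA x⁻¹ (A.inv_mem hx) y⁻¹ (C.inv_mem hy)
    refine ⟨y'⁻¹, C.inv_mem hy', x'⁻¹, A.inv_mem hx', ?_⟩
    rw [← mul_inv_rev, ← h]
    group
  have conj_mem : ∀ g : X, (∀ x ∈ A, ∀ y ∈ C, g * ⁅x, y⁆ * g⁻¹ ∈ ⁅A, C⁆) →
      g ∈ Subgroup.normalizer ((⁅A, C⁆ : Subgroup X) : Set X) := by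
    intro g hg
    have hle : ⁅A, C⁆ ≤ ⁅A, C⁆.comap (MulAut.conj g).toMonoidHom :=
      Subgroup.commutator_le.2 hg
    exact Subgroup.mem_normalizer_fintype fun n hn => hle hn
  have conjA : ∀ g ∈ A, ∀ x ∈ A, ∀ y ∈ C, g * ⁅x, y⁆ * g⁻¹ ∈ ⁅A, C⁆ := by
    intro g hg x hx y hy
    obtain ⟨y₂, hy₂, x₂, hx₂, h⟩ := hAC g hg y hy
    rw [conj_commutatorElement_right h (hAcomm _ hx _ hg) (hAcomm _ hx _ hx₂)]
    exact Subgroup.commutator_mem_commutator hx hy₂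
  constructor
  · refine Subgroup.normal_of_mem_normalizer hM hX (conj_mem _ (conjA a haA))
      (conj_mem _ fun x hx y hy => ?_) (conj_mem _ fun x hx y hy => ?_)
    · obtain ⟨x', hx', y', hy', h⟩ := (hMmem _).1 (hMn.conj_mem y (hCM hy) b)
      have hbx := hinvA x hx
      have e : b * ⁅x, y⁆ * b⁻¹ = x' * ⁅b * x * b⁻¹, y'⁆ * x'⁻¹ := by
        have hc := hAcomm _ hbx _ hx'
        calc b * ⁅x, y⁆ * b⁻¹ = ⁅b * x * b⁻¹, b * y * b⁻¹⁆ := by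
              simp only [commutatorElement_def]; group
          _ = (b * x * b⁻¹ * x') * y' * (b * x * b⁻¹)⁻¹ * y'⁻¹ * x'⁻¹ := by
              rw [h, commutatorElement_def]; group
          _ = x' * ⁅b * x * b⁻¹, y'⁆ * x'⁻¹ := by
              rw [hc, commutatorElement_def]; group
      rw [e]
      exact conjA _ hx' _ hbx _ hy'
    · obtain ⟨x₂, hx₂, y₂, hy₂, h⟩ := hCA x hx c hcC
      rw [conj_commutatorElement_left h (hCcomm _ hy _ hcC) (hCcomm _ hy _ hy₂)]
      exact Subgroup.commutator_mem_commutator hx₂ hy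
  · have := Subgroup.isMulCommutative_closure (k := {g | ∃ x ∈ A, ∃ y ∈ C, ⁅x, y⁆ = g}) (by
      rintro _ ⟨x, hx, y, hy, rfl⟩ _ ⟨x₁, hx₁, y₁, hy₁, rfl⟩
      exact commutatorElement_mul_comm_of_permutable hAcomm hCcomm hCA hAC hx hx₁ hy hy₁)
    rw [← Subgroup.commutator_def] at this
    intro x hx y hy
    exact congrArg Subtype.val (mul_comm' (⟨x, hx⟩ : (⁅A, C⁆ : Subgroup X)) ⟨y, hy⟩)

/-- If `⟨a⟩⟨c⟩` is a subgroup of index at most `2`, with `a` a 2-element inverted by `b`, and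
`⟨c⟩` is core-free of 2-power index, then the whole group is a 2-group. -/
theorem isPGroup_two_of_factorization {X : Type*} [Group X] [Finite X] {M : Subgroup X}
    {a b c : X} (hM : ∀ x, x ∈ M ↔ ∃ i j : ℤ, x = a ^ i * c ^ j)
    (hX : ∀ x, x ∈ M ∨ b⁻¹ * x ∈ M) (hrel : b * a * b⁻¹ = a⁻¹)
    (ha : ∃ k : ℕ, a ^ 2 ^ k = 1) (hC : ∃ k, (Subgroup.zpowers c).index = 2 ^ k)
    (hcore : (Subgroup.zpowers c).normalCore = ⊥) : IsPGroup 2 X := by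
  have hMn : M.Normal := Subgroup.normal_of_mem_or_inv_mul_mem hX
  have haM : a ∈ M := (hM a).2 ⟨1, 0, by simp⟩
  have hcM : c ∈ M := (hM c).2 ⟨0, 1, by simp⟩
  obtain ⟨hQn, hQc⟩ := commutator_zpowers_normal_and_comm hM hX hrel
  have hacQ : ⁅a, c⁆ ∈ ⁅Subgroup.zpowers a, Subgroup.zpowers c⁆ :=
    Subgroup.commutator_mem_commutator (Subgroup.mem_zpowers a) (Subgroup.mem_zpowers c)
  generalize ⁅Subgroup.zpowers a, Subgroup.zpowers c⁆ = Q at *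
  have hQ2 : ∀ q ∈ Q, ∃ k : ℕ, q ^ 2 ^ k = 1 := by
    intro q hq
    obtain ⟨k, hk⟩ := exists_odd_orderOf_pow_two_pow q
    exact ⟨k, Subgroup.eq_one_of_odd_orderOf hC hcore hQn hQc (Q.pow_mem hq _) hk⟩
  have hac : Commute (a : X ⧸ Q) (c : X ⧸ Q) := by
    rw [← commutatorElement_eq_one_iff_commute, ← QuotientGroup.mk'_apply,
      ← QuotientGroup.mk'_apply, ← map_commutatorElement, ← MonoidHom.mem_ker,
      QuotientGroup.ker_mk']
    exact hacQ
  have hcommQ : ∀ x ∈ M, ∀ y ∈ M, Commute (x : X ⧸ Q) (y : X ⧸ Q) := by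
    intro x hx y hy
    obtain ⟨i, j, rfl⟩ := (hM x).1 hx
    obtain ⟨p, q, rfl⟩ := (hM y).1 hy
    simp only [QuotientGroup.mk_mul, QuotientGroup.mk_zpow]
    exact ((Commute.zpow_zpow_self _ _ _).mul_right (hac.zpow_zpow _ _)).mul_left
      ((hac.symm.zpow_zpow _ _).mul_right (Commute.zpow_zpow_self _ _ _))
  let S : Subgroup X :=
    { carrier := {x | x ∈ M ∧ ∃ k : ℕ, x ^ 2 ^ k = 1}
      one_mem' := ⟨M.one_mem, 0, by simp⟩
      mul_mem' := by
        rintro x y ⟨hx, k, hk⟩ ⟨hy, l, hl⟩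
        refine ⟨M.mul_mem hx hy, ?_⟩
        have h1 : (x * y) ^ 2 ^ (k + l) ∈ Q := by
          rw [← QuotientGroup.eq_one_iff, QuotientGroup.mk_pow, QuotientGroup.mk_mul,
            (hcommQ x hx y hy).mul_pow, ← QuotientGroup.mk_pow, ← QuotientGroup.mk_pow]
          have e1 : x ^ 2 ^ (k + l) = 1 := by rw [pow_add, pow_mul, hk, one_pow]
          have e2 : y ^ 2 ^ (k + l) = 1 := by rw [add_comm, pow_add, pow_mul, hl, one_pow]
          rw [e1, e2, QuotientGroup.mk_one, one_mul]
        obtain ⟨m, hm⟩ := hQ2 _ h1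
        exact ⟨k + l + m, by rw [pow_add, pow_mul, hm]⟩
      inv_mem' := by
        rintro x ⟨hx, k, hk⟩
        exact ⟨M.inv_mem hx, k, by rw [inv_pow, hk, inv_one]⟩ }
  have hS : IsPGroup 2 S := by
    rintro ⟨x, hx, k, hk⟩
    exact ⟨k, Subtype.ext (by simpa using hk)⟩
  obtain ⟨k, hk⟩ := exists_odd_orderOf_pow_two_pow c
  set d := c ^ 2 ^ k with hd
  have hdc : d * c = c * d := by rw [hd, ← pow_succ, ← pow_succ']
  have hle := hS.le_centralizer_of_odd_orderOf (a := a) (c := c) (d := d) ⟨haM, ha⟩ hk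
    (fun s hs => ⟨hMn.conj_mem s hs.1 d, by
      obtain ⟨l, hl⟩ := hs.2
      exact ⟨l, by rw [conj_pow, hl]; group⟩⟩) hdc (fun s hs => (hM s).1 hs.1)
  have hda : a * d = d * a := Subgroup.mem_centralizer_singleton_iff.1 (hle ⟨haM, ha⟩)
  have hdM : d ∈ M := M.pow_mem hcM _
  have hdcent : d ∈ M ⊓ Subgroup.centralizer (M : Set X) := by
    refine ⟨hdM, Subgroup.mem_centralizer_iff.2 fun x hx => ?_⟩
    obtain ⟨i, j, rfl⟩ := (hM x).1 hx
    exact ((Commute.zpow_left hda i).mul_left (Commute.zpow_left hdc.symm j)).eq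
  have hd1 : d = 1 := by
    refine Subgroup.eq_one_of_odd_orderOf hC hcore inferInstance ?_ hdcent hk
    intro x hx y hy
    exact Subgroup.mem_centralizer_iff.1 hy.2 x hx.1
  obtain ⟨l, hl⟩ := hC
  have hco : orderOf c ∣ 2 ^ k := orderOf_dvd_of_pow_eq_one hd1
  obtain ⟨m, -, hm⟩ := (Nat.dvd_prime_pow Nat.prime_two).1 hco
  refine IsPGroup.of_card (n := m + l) ?_
  rw [← (Subgroup.zpowers c).card_mul_index, Nat.card_zpowers, hm, hl, pow_add]

/-- If `M = ⟨a⟩⟨c⟩` is a normal subgroup of a finite 2-group and `⟨c⟩` is core-free, then the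
involution of `⟨a⟩` commutes with `c`. -/
theorem IsPGroup.commute_involution {X : Type*} [Group X] [Finite X] (hp : IsPGroup 2 X)
    {M : Subgroup X} {a c z : X} (hMn : M.Normal)
    (hM : ∀ x, x ∈ M ↔ ∃ i j : ℤ, x = a ^ i * c ^ j)
    (hcore : (Subgroup.zpowers c).normalCore = ⊥) (ha1 : a ≠ 1)
    (hz : ∀ y ∈ Subgroup.zpowers a, y ≠ 1 → z ∈ Subgroup.zpowers y) : Commute z c := by
  have haM : a ∈ M := (hM a).2 ⟨1, 0, by simp⟩
  have hcM : c ∈ M := (hM c).2 ⟨0, 1, by simp⟩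
  by_cases h : ∃ i : ℤ, a ^ i ≠ 1 ∧ Commute (a ^ i) c
  · obtain ⟨i, hi, hic⟩ := h
    obtain ⟨m, rfl⟩ := hz _ ⟨i, rfl⟩ hi
    exact hic.zpow_left m
  · exfalso
    push Not at h
    have hle : M ⊓ Subgroup.centralizer (M : Set X) ≤ Subgroup.zpowers c := by
      rintro x ⟨hx, hx'⟩
      obtain ⟨i, j, rfl⟩ := (hM x).1 hx
      have hc := Subgroup.mem_centralizer_iff.1 hx' c hcM
      have : Commute (a ^ i) c := by
        have e : a ^ i * c * c ^ j = c * a ^ i * c ^ j := by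
          rw [mul_assoc c, hc, mul_assoc, mul_assoc, ((Commute.refl c).zpow_right j).eq]
        exact mul_right_cancel e
      have h1 : a ^ i = 1 := by
        by_contra hne
        exact h i hne this
      rw [h1, one_mul]
      exact ⟨j, rfl⟩
    have hbot := Subgroup.normal_le_normalCore.2 hle
    rw [hcore, le_bot_iff] at hbot
    have : Nontrivial M := ⟨⟨⟨a, haM⟩, 1, fun h => ha1 (congrArg Subtype.val h)⟩⟩
    have := (hp.to_subgroup M).center_nontrivial
    obtain ⟨⟨y, hy⟩, hy1⟩ := exists_ne (1 : Subgroup.center M)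
    have : (y : X) ∈ M ⊓ Subgroup.centralizer (M : Set X) := by
      refine ⟨y.2, Subgroup.mem_centralizer_iff.2 fun x hx => ?_⟩
      exact congrArg Subtype.val (Subgroup.mem_center_iff.1 hy ⟨x, hx⟩)
    rw [hbot, Subgroup.mem_bot] at this
    exact hy1 (Subtype.ext (Subtype.ext this))

/-- If `⟨c⟩` is core-free and `z` is central of order dividing `2`, then the core of `⟨c⟩⟨z⟩`
has exponent dividing `2`. -/
theorem Subgroup.exists_mul_of_mem_normalCore_sup {X : Type*} [Group X] {c z : X}
    (hcore : (Subgroup.zpowers c).normalCore = ⊥) (hz : ∀ x, Commute z x) (hz2 : z ^ 2 = 1)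
    {k : X} (hk : k ∈ (Subgroup.zpowers c ⊔ Subgroup.zpowers z).normalCore) :
    ∃ u ∈ Subgroup.zpowers c, ∃ w ∈ Subgroup.zpowers z, u ^ 2 = 1 ∧ w ^ 2 = 1 ∧ k = u * w := by
  have hzpow : ∀ w ∈ Subgroup.zpowers z, w ^ 2 = 1 ∧ ∀ x, Commute w x := by
    rintro _ ⟨i, rfl⟩
    refine ⟨?_, fun x => (hz x).zpow_left i⟩
    simp only
    rw [← zpow_natCast, zpow_comm, zpow_natCast, hz2, one_zpow]
  have hzn : (Subgroup.zpowers z).Normal := by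
    refine ⟨fun w hw g => ?_⟩
    rw [← ((hzpow w hw).2 g).eq, mul_inv_cancel_right]
    exact hw
  have hform : ∀ x ∈ (Subgroup.zpowers c ⊔ Subgroup.zpowers z).normalCore,
      ∃ u ∈ Subgroup.zpowers c, ∃ w ∈ Subgroup.zpowers z, x = u * w := by
    intro x hx
    obtain ⟨u, hu, w, hw, h⟩ :=
      Subgroup.mem_sup_of_normal_right.1 (Subgroup.normalCore_le _ hx)
    exact ⟨u, hu, w, hw, h.symm⟩
  have hKn : (Subgroup.zpowers c ⊔ Subgroup.zpowers z).normalCore.Normal := inferInstance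
  generalize (Subgroup.zpowers c ⊔ Subgroup.zpowers z).normalCore = K at *
  have hsq : ∀ u ∈ Subgroup.zpowers c, ∀ w ∈ Subgroup.zpowers z, (u * w) ^ 2 = u ^ 2 := by
    intro u _ w hw
    rw [Commute.mul_pow ((hzpow w hw).2 u).symm, (hzpow w hw).1, mul_one]
  have hKc : ∀ x ∈ K, ∀ y ∈ K, Commute x y := by
    intro x hx y hy
    obtain ⟨_, ⟨i, rfl⟩, w, hw, rfl⟩ := hform x hx
    obtain ⟨_, ⟨j, rfl⟩, w', hw', rfl⟩ := hform y hy
    exact (((Commute.refl c).zpow_zpow i j).mul_right ((hzpow w' hw').2 _).symm).mul_left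
      ((hzpow w hw).2 _)
  let W : Subgroup X :=
    { carrier := {w | ∃ k ∈ K, k ^ 2 = w}
      one_mem' := ⟨1, K.one_mem, one_pow 2⟩
      mul_mem' := by
        rintro _ _ ⟨x, hx, rfl⟩ ⟨y, hy, rfl⟩
        exact ⟨x * y, K.mul_mem hx hy, (hKc x hx y hy).mul_pow 2⟩
      inv_mem' := by
        rintro _ ⟨x, hx, rfl⟩
        exact ⟨x⁻¹, K.inv_mem hx, inv_pow x 2⟩ }
  have hWn : W.Normal := by
    refine ⟨?_⟩
    rintro _ ⟨x, hx, rfl⟩ g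
    exact ⟨g * x * g⁻¹, hKn.conj_mem x hx g, conj_pow⟩
  have hW : W ≤ (Subgroup.zpowers c).normalCore := by
    refine Subgroup.normal_le_normalCore.2 ?_
    rintro _ ⟨x, hx, rfl⟩
    obtain ⟨u, hu, w, hw, rfl⟩ := hform x hx
    rw [hsq u hu w hw]
    exact Subgroup.pow_mem _ hu 2
  obtain ⟨u, hu, w, hw, rfl⟩ := hform k hk
  refine ⟨u, hu, w, hw, ?_, (hzpow w hw).1, rfl⟩
  rw [← hsq u hu w hw]
  have : (u * w) ^ 2 ∈ W := ⟨_, hk, rfl⟩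
  exact Subgroup.mem_bot.1 (hcore ▸ hW this)

/-- An element `β` inverting `a` commutes with the involution `u` of `⟨c⟩` when
`c⁻¹a²c ∈ ⟨a²⟩u`. -/
theorem commute_of_conj_sq_eq_mul {X : Type*} [Group X] {a c u β : X} {i e t : ℤ}
    (hβa : β⁻¹ * a * β = a⁻¹) (hβc : Commute (β ^ 2) c) (hM : β⁻¹ * c * β = a ^ e * c ^ t)
    (hu : ∀ y ∈ Subgroup.zpowers c, y ≠ 1 → u ∈ Subgroup.zpowers y) (hu2 : u ^ 2 = 1)
    (hau : Commute (a ^ 2) u) (hc : c⁻¹ * a ^ 2 * c = (a ^ 2) ^ i * u) : Commute β u := by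
  have huinv : u⁻¹ = u := inv_eq_of_mul_eq_one_left (by rw [← pow_two, hu2])
  have conj_zpow' : ∀ (x : X) (n : ℤ), β⁻¹ * x ^ n * β = (β⁻¹ * x * β) ^ n := by
    intro x n
    simpa using (conj_zpow (a := β⁻¹) (b := x) (i := n)).symm
  have suff : β⁻¹ * u * β = u → Commute β u := by
    intro h
    have : β * (β⁻¹ * u * β) = β * u := by rw [h]
    exact Eq.symm (by simpa [mul_assoc] using this)
  apply suff
  have hA : ∀ n : ℤ, β⁻¹ * a ^ n * β = a ^ (-n) := by
    intro n
    rw [conj_zpow', hβa, inv_zpow, zpow_neg]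
  have h2 : β⁻¹ * c ^ t * β = a ^ e * c := by
    have h3 : β⁻¹ * (β⁻¹ * c * β) * β = c := by
      have : c = (β ^ 2)⁻¹ * (c * β ^ 2) := by rw [← hβc.eq]; group
      conv_rhs => rw [this, pow_two]
      group
    calc β⁻¹ * c ^ t * β = (β⁻¹ * a ^ e * β)⁻¹ * (β⁻¹ * (a ^ e * c ^ t) * β) := by group
      _ = a ^ e * c := by rw [hA, ← hM, h3]; group
  have h4 : β⁻¹ * c ^ (t - 1) * β = c ^ (-(t - 1)) := by
    calc β⁻¹ * c ^ (t - 1) * β = (β⁻¹ * c * β)⁻¹ * (β⁻¹ * c ^ t * β) := by group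
      _ = c ^ (-(t - 1)) := by rw [hM, h2]; group
  by_cases h1 : c ^ (t - 1) = 1
  · have ht : c ^ t = c := by
      have : c ^ t = c ^ (t - 1) * c := by group
      rw [this, h1, one_mul]
    rw [ht] at hM
    have e1 : β⁻¹ * (c⁻¹ * a ^ 2 * c) * β = (c⁻¹ * a ^ 2 * c)⁻¹ := by
      calc β⁻¹ * (c⁻¹ * a ^ 2 * c) * β
          = (β⁻¹ * c * β)⁻¹ * (β⁻¹ * a ^ (2 : ℤ) * β) * (β⁻¹ * c * β) := by group
        _ = (c⁻¹ * a ^ 2 * c)⁻¹ := by rw [hM, hA]; group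
    rw [hc] at e1
    have e2 : β⁻¹ * (a ^ 2) ^ i * β = ((a ^ 2) ^ i)⁻¹ := by
      have : (a ^ 2) ^ i = a ^ (2 * i) := by rw [zpow_mul]; norm_cast
      rw [this, hA, zpow_neg]
    have hcom : Commute ((a ^ 2) ^ i) u := hau.zpow_left i
    calc β⁻¹ * u * β = (β⁻¹ * (a ^ 2) ^ i * β)⁻¹ * (β⁻¹ * ((a ^ 2) ^ i * u) * β) := by group
      _ = (a ^ 2) ^ i * (u⁻¹ * ((a ^ 2) ^ i)⁻¹) := by rw [e1, e2]; group
      _ = u := by rw [huinv, ← mul_assoc, hcom.eq, mul_inv_cancel_right]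
  · obtain ⟨m, hm⟩ := hu _ ⟨t - 1, rfl⟩ h1
    simp only at hm
    calc β⁻¹ * u * β = (β⁻¹ * c ^ (t - 1) * β) ^ m := by rw [← hm, conj_zpow']
      _ = u⁻¹ := by rw [h4, zpow_neg, inv_zpow, hm]
      _ = u := huinv

/-- The main theorem when the whole group is a 2-group: `c` normalizes `⟨a²⟩`. -/
theorem IsPGroup.conj_sq_mem_zpowers {X : Type*} [Group X] [Finite X] (hp : IsPGroup 2 X)
    {M : Subgroup X} {a b c : X} (hM : ∀ x, x ∈ M ↔ ∃ i j : ℤ, x = a ^ i * c ^ j)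
    (hX : ∀ x, x ∈ M ∨ b⁻¹ * x ∈ M) (hrel : b * a * b⁻¹ = a⁻¹)
    (hb : b ^ 2 ∈ Subgroup.zpowers a)
    (hdisj : ∀ i : ℤ, a ^ i ∈ Subgroup.zpowers c → a ^ i = 1)
    (hcore : (Subgroup.zpowers c).normalCore = ⊥) :
    c⁻¹ * a ^ 2 * c ∈ Subgroup.zpowers (a ^ 2) := by
  induction hN : Nat.card X using Nat.strong_induction_on generalizing X with
  | _ N ih =>
  have hMn : M.Normal := Subgroup.normal_of_mem_or_inv_mul_mem hX
  have haM : a ∈ M := (hM a).2 ⟨1, 0, by simp⟩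
  have hcM : c ∈ M := (hM c).2 ⟨0, 1, by simp⟩
  by_cases ha2 : a ^ 2 = 1
  · simp [ha2]
  have ha1 : a ≠ 1 := by
    rintro rfl
    simp at ha2
  have central : ∀ x : X, Commute x a → Commute x b → Commute x c → ∀ y, Commute x y := by
    intro x hxa hxb hxc y
    have hle : ∀ y ∈ M, Commute x y := by
      intro y hy
      obtain ⟨i, j, rfl⟩ := (hM y).1 hy
      exact (hxa.zpow_right i).mul_right (hxc.zpow_right j)
    rcases hX y with hy | hy
    · exact hle y hy
    · simpa using hxb.mul_right (hle _ hy)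
  obtain ⟨z, hzA, hz1, hz2, hz⟩ := exists_involution_of_pow_two_pow_eq_one (hp a) ha1
  have hzb : Commute z b := by
    obtain ⟨i, rfl⟩ := hzA
    have h1 : b * a ^ i * b⁻¹ = a ^ i := by
      rw [← conj_zpow, hrel, inv_zpow]
      exact inv_eq_of_mul_eq_one_left (by rw [← pow_two]; exact hz2)
    exact (mul_inv_eq_iff_eq_mul.1 h1).symm
  have hzZ : ∀ y, Commute z y := by
    refine central z ?_ hzb (hp.commute_involution hMn hM hcore ha1 hz)
    obtain ⟨i, rfl⟩ := hzA
    exact Commute.zpow_self a i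
  have eq_of_mem_zpowers : ∀ v w : X, w ^ 2 = 1 → v ∈ Subgroup.zpowers w → v ≠ 1 → v = w := by
    rintro _ w hw ⟨m, rfl⟩ hv
    simp only at hv ⊢
    have hw' : w ^ (2 : ℤ) = 1 := by exact_mod_cast hw
    rcases Int.even_or_odd' m with ⟨r, rfl | rfl⟩
    · rw [zpow_mul, hw', one_zpow] at hv
      exact absurd rfl hv
    · rw [zpow_add, zpow_mul, hw', one_zpow, one_mul, zpow_one]
  have hb2c : Commute (b ^ 2) c := by
    by_cases hb1 : b ^ 2 = 1
    · rw [hb1]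
      exact Commute.one_left c
    · have hb4 : (b ^ 2) ^ 2 = 1 := by
        obtain ⟨i, hi⟩ := hb
        have h1 : b * b ^ 2 * b⁻¹ = (b ^ 2)⁻¹ := by
          simp only at hi
          rw [← hi, ← conj_zpow, hrel, inv_zpow]
        have h2 : b * b ^ 2 * b⁻¹ = b ^ 2 := by group
        rw [pow_two (b ^ 2), mul_eq_one_iff_eq_inv, ← h1, h2]
      rw [← eq_of_mem_zpowers z _ hb4 (hz _ hb hb1) hz1]
      exact hzZ c
  set K := (Subgroup.zpowers c ⊔ Subgroup.zpowers z).normalCore with hK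
  have hKn : K.Normal := inferInstance
  have hKform : ∀ k ∈ K, ∃ u ∈ Subgroup.zpowers c, ∃ w ∈ Subgroup.zpowers z,
      u ^ 2 = 1 ∧ w ^ 2 = 1 ∧ k = u * w := fun k hk =>
    Subgroup.exists_mul_of_mem_normalCore_sup hcore hzZ hz2 hk
  have hzK : Subgroup.zpowers z ≤ K := by
    have : (Subgroup.zpowers z).Normal := by
      refine ⟨?_⟩
      rintro _ ⟨i, rfl⟩ g
      simp only
      rw [← ((hzZ g).zpow_left i).eq, mul_inv_cancel_right]
      exact ⟨i, rfl⟩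
    exact Subgroup.normal_le_normalCore.2 le_sup_right
  have hwZ : ∀ w ∈ Subgroup.zpowers z, ∀ y, Commute w y := by
    rintro _ ⟨i, rfl⟩ y
    exact (hzZ y).zpow_left i
  have hzdisj : ∀ w ∈ Subgroup.zpowers z, w ∈ Subgroup.zpowers c → w = 1 := by
    intro w hw hwc
    obtain ⟨i, rfl⟩ := Subgroup.zpowers_le.2 hzA hw
    exact hdisj i hwc
  have hquot : c⁻¹ * a ^ 2 * c ∈ Subgroup.zpowers (a ^ 2) ⊔ K := by
    have hcard : Nat.card (X ⧸ K) < N := by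
      have h1 : 1 < Nat.card K := by
        rw [Subgroup.one_lt_card_iff_ne_bot]
        intro hbot
        exact hz1 (Subgroup.mem_bot.1 (hbot ▸ hzK (Subgroup.mem_zpowers z)))
      rw [← hN, Subgroup.card_eq_card_quotient_mul_card_subgroup K]
      exact lt_mul_of_one_lt_right Nat.card_pos h1
    have key := ih _ hcard (X := X ⧸ K) (hp.to_quotient K)
      (M := M.map (QuotientGroup.mk' K)) (a := (a : X ⧸ K)) (b := (b : X ⧸ K))
      (c := (c : X ⧸ K)) ?_ ?_ ?_ ?_ ?_ ?_ rfl
    · obtain ⟨i, hi⟩ := key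
      have hi' : (((a ^ 2) ^ i : X) : X ⧸ K) = (c⁻¹ * a ^ 2 * c : X) := hi
      have hk := QuotientGroup.eq.1 hi'
      have := Subgroup.mul_mem_sup (Subgroup.zpow_mem_zpowers (a ^ 2) i) hk
      simpa using this
    · intro x
      constructor
      · rintro ⟨y, hy, rfl⟩
        obtain ⟨i, j, rfl⟩ := (hM y).1 hy
        exact ⟨i, j, rfl⟩
      · rintro ⟨i, j, rfl⟩
        exact ⟨a ^ i * c ^ j, (hM _).2 ⟨i, j, rfl⟩, rfl⟩
    · intro x
      induction x using QuotientGroup.induction_on with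
      | H x =>
      rcases hX x with hx | hx
      · exact Or.inl ⟨x, hx, rfl⟩
      · exact Or.inr ⟨_, hx, rfl⟩
    · exact congrArg (QuotientGroup.mk' K) hrel
    · obtain ⟨i, hi⟩ := hb
      exact ⟨i, congrArg (QuotientGroup.mk' K) hi⟩
    · rintro i ⟨j, hj⟩
      have hj' : ((c ^ j : X) : X ⧸ K) = (a ^ i : X) := hj
      obtain ⟨u, hu, w, hw, -, -, h⟩ := hKform _ (QuotientGroup.eq.1 hj')
      have h1 : a ^ i * w⁻¹ = c ^ j * u := by
        rw [mul_inv_eq_iff_eq_mul, mul_assoc, ← h, mul_inv_cancel_left]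
      have hwA : w ∈ Subgroup.zpowers a := Subgroup.zpowers_le.2 hzA hw
      obtain ⟨m, hm⟩ := Subgroup.mul_mem _ (Subgroup.zpow_mem_zpowers a i)
        (Subgroup.inv_mem _ hwA)
      have h2 : a ^ i * w⁻¹ = 1 := by
        rw [← hm]
        refine hdisj m ?_
        simp only at hm
        rw [hm, h1]
        exact Subgroup.mul_mem _ (Subgroup.zpow_mem_zpowers c j) hu
      have h3 : a ^ i ∈ K := by
        rw [mul_inv_eq_one.1 h2]
        exact hzK hw
      exact (QuotientGroup.eq_one_iff _).2 h3
    · have hle : ((Subgroup.zpowers (c : X ⧸ K)).normalCore).comap (QuotientGroup.mk' K) ≤ K := by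
        refine Subgroup.normal_le_normalCore.2 fun x hx => ?_
        obtain ⟨j, hj⟩ := Subgroup.normalCore_le _ (Subgroup.mem_comap.1 hx)
        have hj' : ((c ^ j : X) : X ⧸ K) = (x : X) := hj
        have h1 := Subgroup.normalCore_le _ (QuotientGroup.eq.1 hj')
        have h2 : c ^ j ∈ Subgroup.zpowers c ⊔ Subgroup.zpowers z :=
          Subgroup.mem_sup_left ⟨j, rfl⟩
        simpa using Subgroup.mul_mem _ h2 h1
      rw [eq_bot_iff]
      intro x hx
      induction x using QuotientGroup.induction_on with
      | H x => exact Subgroup.mem_bot.2 ((QuotientGroup.eq_one_iff x).2 (hle hx))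
  obtain ⟨g, hg, k, hk, hgk⟩ := Subgroup.mem_sup_of_normal_right.1 hquot
  obtain ⟨u, hu, w, hw, hu2, hw2, rfl⟩ := hKform k hk
  have hzA2 : Subgroup.zpowers z ≤ Subgroup.zpowers (a ^ 2) :=
    Subgroup.zpowers_le.2 (hz _ (Subgroup.pow_mem _ (Subgroup.mem_zpowers a) 2) ha2)
  have hgw : c⁻¹ * a ^ 2 * c = g * w * u := by
    rw [← hgk, mul_assoc, (hwZ w hw u).eq]
  have hgwA : g * w ∈ Subgroup.zpowers (a ^ 2) := Subgroup.mul_mem _ hg (hzA2 hw)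
  by_cases hu1 : u = 1
  · rw [hgw, hu1, mul_one]
    exact hgwA
  exfalso
  obtain ⟨i, hi⟩ := hgwA
  simp only at hi
  rw [← hi] at hgw
  have huK : u ∈ K := by
    have := K.mul_mem hk (K.inv_mem (hzK hw))
    rwa [mul_inv_cancel_right] at this
  have huinv : ∀ y ∈ Subgroup.zpowers c, y ≠ 1 → u ∈ Subgroup.zpowers y := by
    have hc1 : c ≠ 1 := by
      rintro rfl
      simp at hu
      exact hu1 hu
    obtain ⟨v, -, hv1, -, hv⟩ := exists_involution_of_pow_two_pow_eq_one (hp c) hc1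
    rw [← eq_of_mem_zpowers v u hu2 (hv u hu hu1) hv1]
    exact hv
  have hau : Commute (a ^ 2) u := by
    obtain ⟨u', hu', w', hw', hu2', hw2', h⟩ := hKform _ (hKn.conj_mem u huK a)
    have hu'u : u = u' := by
      refine eq_of_mem_zpowers u u' hu2' (huinv u' hu' ?_) hu1
      rintro rfl
      rw [one_mul] at h
      have : u = w' := by
        have h1 : u = a⁻¹ * (a * u * a⁻¹) * a := by group
        rw [h1, h, mul_assoc, (hwZ w' hw' a).eq, inv_mul_cancel_left]
      exact hu1 (hzdisj u (this ▸ hw') hu)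
    subst hu'u
    have h1 : a ^ 2 * u * (a ^ 2)⁻¹ = u := by
      calc a ^ 2 * u * (a ^ 2)⁻¹ = a * (a * u * a⁻¹) * a⁻¹ := by rw [pow_two]; group
        _ = (a * u) * (w' * a⁻¹) := by rw [h]; group
        _ = (a * u * a⁻¹) * w' := by rw [(hwZ w' hw' _).eq]; group
        _ = u := by rw [h, mul_assoc, ← pow_two, hw2', mul_one]
    exact mul_inv_eq_iff_eq_mul.1 h1
  have hcomm : ∀ β : X, β⁻¹ * a * β = a⁻¹ → Commute (β ^ 2) c → Commute β u := by
    intro β hβa hβc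
    have hm : β⁻¹ * c * β ∈ M := by simpa using hMn.conj_mem c hcM β⁻¹
    obtain ⟨e, t, het⟩ := (hM _).1 hm
    exact commute_of_conj_sq_eq_mul hβa hβc het huinv hu2 hau hgw
  have hab : a * b = b * a⁻¹ := by
    have h1 : b * a = a⁻¹ * b := mul_inv_eq_iff_eq_mul.1 hrel
    calc a * b = a * (b * a) * a⁻¹ := by group
      _ = b * a⁻¹ := by rw [h1]; group
  have hbu : Commute b u := hcomm b (by rw [mul_assoc, hab]; group) hb2c
  have hbau : Commute (b * a) u := by
    refine hcomm (b * a) ?_ ?_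
    · calc (b * a)⁻¹ * a * (b * a) = a⁻¹ * b⁻¹ * (a * b) * a := by group
        _ = a⁻¹ := by rw [hab]; group
    · have : (b * a) ^ 2 = b ^ 2 := by
        calc (b * a) ^ 2 = b * (a * b) * a := by rw [pow_two]; group
          _ = b ^ 2 := by rw [hab, pow_two]; group
      rw [this]
      exact hb2c
  have hau1 : Commute a u := by
    simpa using hbu.inv_left.mul_left hbau
  have huc : Commute u c := by
    obtain ⟨m, rfl⟩ := hu
    exact Commute.zpow_self c m
  have huZ := central u hau1.symm hbu.symm huc
  have hun : (Subgroup.zpowers u).Normal := by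
    refine ⟨?_⟩
    rintro _ ⟨m, rfl⟩ g
    simp only
    rw [← ((huZ g).zpow_left m).eq, mul_inv_cancel_right]
    exact ⟨m, rfl⟩
  have := Subgroup.normal_le_normalCore.2 (Subgroup.zpowers_le.2 hu)
  rw [hcore] at this
  exact hu1 (Subgroup.mem_bot.1 (this (Subgroup.mem_zpowers u)))

/-- If `b` inverts `a` and `b² ∈ ⟨a⟩`, then `⟨a, b⟩ = ⟨a⟩ ∪ b⟨a⟩`. -/
theorem mem_zpowers_or_of_mem_closure_pair {X : Type*} [Group X] {a b g : X}
    (hrel : b * a * b⁻¹ = a⁻¹) (hb : b ^ 2 ∈ Subgroup.zpowers a)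
    (hg : g ∈ Subgroup.closure {a, b}) :
    g ∈ Subgroup.zpowers a ∨ b⁻¹ * g ∈ Subgroup.zpowers a := by
  have hinv : ∀ i : ℤ, b⁻¹ * a ^ i = a ^ (-i) * b⁻¹ := by
    intro i
    have : b * a ^ (-i) * b⁻¹ = a ^ i := by rw [← conj_zpow, hrel, inv_zpow', neg_neg]
    rw [← this]
    group
  have hmul : ∀ x y, (x = a ∨ x = a⁻¹) → (y ∈ Subgroup.zpowers a ∨ b⁻¹ * y ∈ Subgroup.zpowers a) →
      x * y ∈ Subgroup.zpowers a ∨ b⁻¹ * (x * y) ∈ Subgroup.zpowers a := by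
    intro x y hx hy
    obtain ⟨i, rfl⟩ : x ∈ Subgroup.zpowers a := by
      rcases hx with rfl | rfl
      · exact Subgroup.mem_zpowers _
      · exact Subgroup.inv_mem _ (Subgroup.mem_zpowers _)
    refine hy.imp (Subgroup.mul_mem _ ⟨i, rfl⟩) fun h => ?_
    simp only
    rw [← mul_assoc, hinv, mul_assoc]
    exact Subgroup.mul_mem _ (Subgroup.zpow_mem_zpowers a _) h
  induction hg using Subgroup.closure_induction_left with
  | one => exact Or.inl (Subgroup.one_mem _)
  | mul_left x hx y hy ih =>
    rcases hx with rfl | rfl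
    · exact hmul x y (Or.inl rfl) ih
    · rcases ih with h | h
      · exact Or.inr (by rwa [inv_mul_cancel_left])
      · refine Or.inl ?_
        have := Subgroup.mul_mem _ hb h
        rwa [pow_two, mul_assoc, mul_inv_cancel_left] at this
  | inv_mul_cancel x hx y hy ih =>
    rcases hx with rfl | rfl
    · exact hmul x⁻¹ y (Or.inr rfl) ih
    · rcases ih with h | h
      · refine Or.inr ?_
        have := Subgroup.mul_mem _ (Subgroup.inv_mem _ hb) h
        rwa [pow_two, mul_inv_rev, mul_assoc] at this
      · exact Or.inl h

/-- If `X = G⟨c⟩` with `G` a dihedral or generalized quaternion 2-group, `⟨a⟩⟨c⟩` a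
subgroup of `X` and `⟨c⟩` core-free, then `⟨a²⟩ ⊴ X`. -/
theorem normal_zpowers_a_sq_of_two_group {X : Type*} [Group X] [Finite X]
    (n : ℕ) (hn : 2 ≤ n) (a b c : X) (G : Subgroup X)
    (hGgen : G = Subgroup.closure {a, b})
    (hrel : b * a * b⁻¹ = a⁻¹)
    (hGtype : (orderOf a = n ∧ orderOf b = 2 ∧ Nat.card G = 2 * n) ∨
      (orderOf a = 2 * n ∧ b ^ 2 = a ^ n ∧ Nat.card G = 4 * n))
    (h2 : ∃ k : ℕ, Nat.card G = 2 ^ k)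
    (hint : G ⊓ Subgroup.zpowers c = ⊥)
    (hfact : ∀ x : X, ∃ g ∈ G, ∃ k : ℤ, x = g * c ^ k)
    (hM : ∃ M : Subgroup X,
      (M : Set X) = (Subgroup.zpowers a : Set X) * (Subgroup.zpowers c : Set X))
    (hcore : (Subgroup.zpowers c).normalCore = ⊥) :
    (Subgroup.zpowers (a ^ 2)).Normal := by
  have hb : b ^ 2 ∈ Subgroup.zpowers a := by
    rcases hGtype with ⟨-, h, -⟩ | ⟨-, h, -⟩
    · rw [← h, pow_orderOf_eq_one]
      exact Subgroup.one_mem _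
    · rw [h]
      exact Subgroup.pow_mem _ (Subgroup.mem_zpowers a) n
  have haG : a ∈ G := hGgen ▸ Subgroup.subset_closure (by simp)
  have hG : ∀ g ∈ G, g ∈ Subgroup.zpowers a ∨ b⁻¹ * g ∈ Subgroup.zpowers a :=
    hGgen ▸ fun _ => mem_zpowers_or_of_mem_closure_pair hrel hb
  obtain ⟨M, hMset⟩ := hM
  have hMmem : ∀ x, x ∈ M ↔ ∃ i j : ℤ, x = a ^ i * c ^ j := by
    intro x
    rw [← SetLike.mem_coe, hMset, Set.mem_mul]
    constructor
    · rintro ⟨_, ⟨i, rfl⟩, _, ⟨j, rfl⟩, h⟩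
      exact ⟨i, j, h.symm⟩
    · rintro ⟨i, j, h⟩
      exact ⟨_, ⟨i, rfl⟩, _, ⟨j, rfl⟩, h.symm⟩
  have hX : ∀ x, x ∈ M ∨ b⁻¹ * x ∈ M := by
    intro x
    obtain ⟨g, hg, k, rfl⟩ := hfact x
    rcases hG g hg with ⟨i, rfl⟩ | ⟨i, hi⟩
    · exact Or.inl ((hMmem _).2 ⟨i, k, rfl⟩)
    · exact Or.inr ((hMmem _).2 ⟨i, k, by rw [← mul_assoc, ← hi]⟩)
  have hdisj : ∀ i : ℤ, a ^ i ∈ Subgroup.zpowers c → a ^ i = 1 := fun i hi =>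
    Subgroup.mem_bot.1 (hint ▸ ⟨G.zpow_mem haG i, hi⟩)
  obtain ⟨k, hk⟩ := h2
  have ha : ∃ k : ℕ, a ^ 2 ^ k = 1 := by
    refine ⟨k, orderOf_dvd_iff_pow_eq_one.1 ?_⟩
    rw [← hk]
    exact G.orderOf_dvd_natCard haG
  have hindex : (Subgroup.zpowers c).index = 2 ^ k := by
    rw [← hk]
    refine (Subgroup.isComplement'_of_disjoint_and_mul_eq_univ
      (disjoint_iff.2 hint) ?_).index_eq_card
    refine Set.eq_univ_of_forall fun x => ?_
    obtain ⟨g, hg, m, rfl⟩ := hfact x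
    exact Set.mul_mem_mul hg ⟨m, rfl⟩
  have hp := isPGroup_two_of_factorization hMmem hX hrel ha ⟨k, hindex⟩ hcore
  have hc := hp.conj_sq_mem_zpowers hMmem hX hrel hb hdisj hcore
  have hnorm : ∀ g : X, g * a ^ 2 * g⁻¹ ∈ Subgroup.zpowers (a ^ 2) →
      g ∈ Subgroup.normalizer (Subgroup.zpowers (a ^ 2) : Set X) := by
    refine fun g hg => Subgroup.mem_normalizer_fintype ?_
    rintro _ ⟨m, rfl⟩
    simp only [← conj_zpow]
    exact Subgroup.zpow_mem _ hg m
  refine Subgroup.normal_of_mem_normalizer hMmem hX (hnorm a ?_) (hnorm b ?_) ?_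
  · exact ⟨1, by group⟩
  · rw [← conj_pow, hrel, inv_pow]
    exact Subgroup.inv_mem _ (Subgroup.mem_zpowers _)
  · exact inv_mem_iff.1 (hnorm c⁻¹ (by rwa [inv_inv]))
end

section
/- Let X = D⟨c⟩ be a finite group with D = ⟨a,b⟩ ≅ D_{2n} dihedral (n ≥ 2), ⟨c⟩ cyclic, D ∩ ⟨c⟩ = 1, the subset ⟨a⟩⟨c⟩ a subgroup of X, and the core of ⟨c⟩ in X trivial. Then ⟨a^2⟩ is normal in X. -/
open scoped Pointwise

theorem mem_zpowers_of_orderOf_dvd {X : Type*} [Group X] [Finite X] {g x y : X}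
    (hx : x ∈ Subgroup.zpowers g) (hy : y ∈ Subgroup.zpowers g)
    (h : orderOf x ∣ orderOf y) : x ∈ Subgroup.zpowers y := by
  classical
  obtain ⟨_⟩ := nonempty_fintype (Subgroup.zpowers g)
  lift x to Subgroup.zpowers g using hx
  lift y to Subgroup.zpowers g using hy
  rw [Subgroup.orderOf_coe, Subgroup.orderOf_coe] at h
  suffices hxy : x ∈ Subgroup.zpowers y by
    obtain ⟨k, rfl⟩ := Subgroup.mem_zpowers_iff.1 hxy
    exact Subgroup.mem_zpowers_iff.2 ⟨k, by simp⟩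
  have hle := IsCyclic.card_pow_eq_one_le (α := Subgroup.zpowers g) (orderOf_pos y)
  have hsub : (Finset.univ.filter (· ∈ Subgroup.zpowers y)) ⊆
      Finset.univ.filter (fun t : Subgroup.zpowers g => t ^ orderOf y = 1) := by
    intro t ht
    simp only [Finset.mem_filter, Finset.mem_univ, true_and] at ht ⊢
    exact orderOf_dvd_iff_pow_eq_one.1 (orderOf_dvd_of_mem_zpowers ht)
  have hcard : (Finset.univ.filter (· ∈ Subgroup.zpowers y)).card = orderOf y := by
    rw [← Nat.card_zpowers, ← Fintype.card_subtype, ← Nat.card_eq_fintype_card]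
  have heq := Finset.eq_of_subset_of_card_le hsub (hcard ▸ hle)
  have hmem : x ∈ Finset.univ.filter (fun t : Subgroup.zpowers g => t ^ orderOf y = 1) := by
    simpa using orderOf_dvd_iff_pow_eq_one.1 h
  rw [← heq] at hmem
  simpa using hmem

theorem mem_normalizer_zpowers {X : Type*} [Group X] [Finite X] {g s : X}
    (h : g * s * g⁻¹ ∈ Subgroup.zpowers s) :
    g ∈ Subgroup.normalizer (Subgroup.zpowers s : Set X) := by
  refine Subgroup.mem_normalizer_fintype fun x hx => ?_
  obtain ⟨k, rfl⟩ := Subgroup.mem_zpowers_iff.1 hx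
  rw [← conj_zpow]
  exact Subgroup.zpow_mem _ h k

theorem conj_eq_inv_of_mem_zpowers {X : Type*} [Group X] {t x z : X}
    (h : t * x * t⁻¹ = x⁻¹) (hz : z ∈ Subgroup.zpowers x) : t * z * t⁻¹ = z⁻¹ := by
  obtain ⟨k, rfl⟩ := Subgroup.mem_zpowers_iff.1 hz
  rw [← conj_zpow, h, inv_zpow]

/-- If an involution `t` inverts `u` and `t * f * t⁻¹ = u * f'`, then `t` inverts `f⁻¹ * f'`. -/
theorem conj_inv_mul_eq_inv {X : Type*} [Group X] {t u f f' : X} (ht : t * t = 1)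
    (hu : t * u * t⁻¹ = u⁻¹) (h : t * f * t⁻¹ = u * f') :
    t * (f⁻¹ * f') * t⁻¹ = (f⁻¹ * f')⁻¹ := by
  have htinv : t⁻¹ = t := inv_eq_of_mul_eq_one_left ht
  have hf : f = u⁻¹ * (t * f' * t⁻¹) :=
    calc f = t * (t * f * t⁻¹) * t⁻¹ := by
          rw [htinv]; simp only [mul_assoc, ht, mul_one]; rw [← mul_assoc, ht, one_mul]
      _ = (t * u * t⁻¹) * (t * f' * t⁻¹) := by rw [h]; group
      _ = _ := by rw [hu]
  have hf' : t * f' * t⁻¹ = u * f := by rw [eq_inv_mul_iff_mul_eq] at hf; exact hf.symm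
  calc t * (f⁻¹ * f') * t⁻¹ = (t * f * t⁻¹)⁻¹ * (t * f' * t⁻¹) := by group
    _ = _ := by rw [h, hf']; group

theorem mem_closure_pair_dihedral {X : Type*} [Group X] {a b g : X} (hb : b * b = 1)
    (hrel : b * a * b⁻¹ = a⁻¹) (hg : g ∈ Subgroup.closure {a, b}) :
    ∃ i : ℤ, g = a ^ i ∨ g = b * a ^ i := by
  have hbinv : b⁻¹ = b := inv_eq_of_mul_eq_one_left hb
  have hconj (i : ℤ) : b * a ^ i = a ^ (-i) * b := by
    have : b * a ^ i * b⁻¹ = a ^ (-i) := by rw [← conj_zpow, hrel, inv_zpow, zpow_neg]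
    rw [← this]; group
  have hconj' (i : ℤ) : a ^ i * b = b * a ^ (-i) := by rw [hconj, neg_neg]
  induction hg using Subgroup.closure_induction with
  | mem x hx =>
    rcases hx with rfl | rfl
    · exact ⟨1, Or.inl (zpow_one _).symm⟩
    · exact ⟨0, Or.inr (by simp)⟩
  | one => exact ⟨0, Or.inl (by simp)⟩
  | mul x y _ _ hx hy =>
    obtain ⟨i, rfl | rfl⟩ := hx <;> obtain ⟨j, rfl | rfl⟩ := hy
    · exact ⟨i + j, Or.inl (zpow_add _ _ _).symm⟩
    · exact ⟨-i + j, Or.inr (by rw [← mul_assoc, hconj', mul_assoc, zpow_add])⟩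
    · exact ⟨i + j, Or.inr (by rw [mul_assoc, zpow_add])⟩
    · refine ⟨-i + j, Or.inl ?_⟩
      rw [mul_assoc, ← mul_assoc (a ^ i), hconj', ← mul_assoc, ← mul_assoc, hb, one_mul, zpow_add]
  | inv x _ hx =>
    obtain ⟨i, rfl | rfl⟩ := hx
    · exact ⟨-i, Or.inl (zpow_neg _ _).symm⟩
    · exact ⟨i, Or.inr (by rw [mul_inv_rev, hbinv, ← zpow_neg, hconj])⟩

/-- If `X = D⟨c⟩` with `D` dihedral, `D ∩ ⟨c⟩ = 1`, `⟨a⟩⟨c⟩` a subgroup of `X`, and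
`⟨c⟩` core-free, then `⟨a²⟩ ⊴ X`. -/
theorem normal_zpowers_a_sq_dihedral {X : Type*} [Group X] [Finite X]
    (n : ℕ) (hn : 2 ≤ n) (a b c : X) (D : Subgroup X)
    (hDgen : D = Subgroup.closure {a, b})
    (hoa : orderOf a = n) (hob : orderOf b = 2)
    (hrel : b * a * b⁻¹ = a⁻¹) (hcardD : Nat.card D = 2 * n)
    (hint : D ⊓ Subgroup.zpowers c = ⊥)
    (hfact : ∀ x : X, ∃ g ∈ D, ∃ k : ℤ, x = g * c ^ k)
    (hM : ∃ M : Subgroup X,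
      (M : Set X) = (Subgroup.zpowers a : Set X) * (Subgroup.zpowers c : Set X))
    (hcore : (Subgroup.zpowers c).normalCore = ⊥) :
    (Subgroup.zpowers (a ^ 2)).Normal := by
  obtain ⟨M, hM⟩ := hM
  have hb : b * b = 1 := by rw [← sq, ← hob]; exact pow_orderOf_eq_one b
  have hbinv : b⁻¹ = b := inv_eq_of_mul_eq_one_left hb
  have haD : a ∈ D := hDgen ▸ Subgroup.subset_closure (by simp)
  have hbD : b ∈ D := hDgen ▸ Subgroup.subset_closure (by simp)
  have hD (g : X) (hg : g ∈ D) : ∃ i : ℤ, g = a ^ i ∨ g = b * a ^ i :=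
    mem_closure_pair_dihedral hb hrel (hDgen ▸ hg)
  have hDC (x : X) (hx : x ∈ D) (hx' : x ∈ Subgroup.zpowers c) : x = 1 := by
    have : x ∈ D ⊓ Subgroup.zpowers c := ⟨hx, hx'⟩
    rwa [hint, Subgroup.mem_bot] at this
  have hbA : b ∉ Subgroup.zpowers a := by
    intro h
    have : D ≤ Subgroup.zpowers a := by
      rw [hDgen, Subgroup.closure_le]
      rintro x (rfl | rfl)
      · exact Subgroup.mem_zpowers _
      · exact h
    have := Subgroup.card_le_of_le this
    rw [hcardD, Nat.card_zpowers, hoa] at this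
    omega
  have hmemM (x : X) : x ∈ M ↔ ∃ i j : ℤ, x = a ^ i * c ^ j := by
    rw [← SetLike.mem_coe, hM, Set.mem_mul]
    constructor
    · rintro ⟨_, ⟨i, rfl⟩, _, ⟨j, rfl⟩, rfl⟩
      exact ⟨i, j, rfl⟩
    · rintro ⟨i, j, rfl⟩
      exact ⟨_, ⟨i, rfl⟩, _, ⟨j, rfl⟩, rfl⟩
  have haM (i : ℤ) : a ^ i ∈ M := (hmemM _).2 ⟨i, 0, by simp⟩
  have hcM (i : ℤ) : c ^ i ∈ M := (hmemM _).2 ⟨0, i, by simp⟩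
  have hbM : b ∉ M := by
    intro h
    obtain ⟨i, j, hij⟩ := (hmemM _).1 h
    have h1 : a ^ (-i) * b = c ^ j := by rw [hij]; group
    have h2 := hDC (c ^ j) (h1 ▸ mul_mem (zpow_mem haD _) hbD) ⟨j, rfl⟩
    rw [h2, mul_one] at hij
    exact hbA ⟨i, hij.symm⟩
  have hainv (i j : ℤ) : (b * a ^ i) * a ^ j * (b * a ^ i)⁻¹ = (a ^ j)⁻¹ := by
    have : (b * a ^ i) * a ^ j * (b * a ^ i)⁻¹ = b * a ^ j * b⁻¹ := by group
    rw [this, ← conj_zpow, hrel, inv_zpow]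
  have hinvol (i : ℤ) : (b * a ^ i) * (b * a ^ i) = 1 := by
    have h0 := hainv 0 i
    rw [zpow_zero, mul_one, hbinv] at h0
    rw [← mul_assoc, h0, inv_mul_cancel]
  have hstep (i : ℤ) (f : X) (hf : f ∈ Subgroup.zpowers c) :
      ∃ j : ℤ, ∃ x ∈ Subgroup.zpowers c,
        (b * a ^ i) * x * (b * a ^ i)⁻¹ = x⁻¹ ∧
          f * (b * a ^ i) = (b * a ^ i) * a ^ j * f * x := by
    set t := b * a ^ i with ht
    have hfM : f ∈ M := by
      obtain ⟨k, rfl⟩ := Subgroup.mem_zpowers_iff.1 hf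
      exact hcM k
    have htt : t * t = 1 := hinvol i
    have htinv : t⁻¹ = t := inv_eq_of_mul_eq_one_left htt
    obtain ⟨g, hg, k, hgk⟩ := hfact (t * f * t⁻¹)
    obtain ⟨j, rfl | rfl⟩ := hD g hg
    · refine ⟨j, f⁻¹ * c ^ k, mul_mem (inv_mem hf) ⟨k, rfl⟩,
        conj_inv_mul_eq_inv htt (hainv i j) hgk, ?_⟩
      have : t * a ^ j * f * (f⁻¹ * c ^ k) = t * (a ^ j * c ^ k) := by group
      rw [this, ← hgk, htinv, mul_assoc t f t, ← mul_assoc t t, htt, one_mul]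
    · refine absurd ?_ hbM
      have h1 : b = f⁻¹ * (a ^ (-i) * a ^ j * c ^ k) * a ^ (-i) := by
        have h2 : a ^ i * f * t⁻¹ = a ^ j * c ^ k := by
          rw [ht, mul_assoc b, mul_assoc b, mul_assoc b] at hgk
          exact mul_left_cancel hgk
        rw [htinv, ht] at h2
        rw [mul_assoc (a ^ (-i)), ← h2]; group
      rw [h1]
      exact mul_mem (mul_mem (inv_mem hfM) (mul_mem (mul_mem (haM _) (haM _)) (hcM _))) (haM _)
  have hnormal (z : X) (hza : a * z * a⁻¹ ∈ Subgroup.zpowers z)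
      (hzb : b * z * b⁻¹ ∈ Subgroup.zpowers z) (hzc : c * z * c⁻¹ ∈ Subgroup.zpowers z) :
      (Subgroup.zpowers z).Normal := by
    rw [← Subgroup.normalizer_eq_top_iff, Subgroup.eq_top_iff']
    intro x
    obtain ⟨g, hg, k, rfl⟩ := hfact x
    have hDN : D ≤ Subgroup.normalizer (Subgroup.zpowers z : Set X) := by
      rw [hDgen, Subgroup.closure_le]
      rintro x (rfl | rfl)
      · exact mem_normalizer_zpowers hza
      · exact mem_normalizer_zpowers hzb
    exact mul_mem (hDN hg) (zpow_mem (mem_normalizer_zpowers hzc) k)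
  have hcC : c ∈ Subgroup.zpowers c := Subgroup.mem_zpowers c
  have hkey (i : ℤ) : ∃ s : ℤ, ∃ x ∈ Subgroup.zpowers c, ∃ y ∈ Subgroup.zpowers c,
      (b * a ^ i) * x * (b * a ^ i)⁻¹ = x⁻¹ ∧
      (b * a ^ (i + 2)) * y * (b * a ^ (i + 2))⁻¹ = y⁻¹ ∧
      c * a ^ 2 = a ^ s * (c * (x * y)) := by
    obtain ⟨j, x, hx, hxi, h1⟩ := hstep i c hcC
    obtain ⟨k, y, hy, hyi, h2⟩ := hstep (i + 2) (c * x) (mul_mem hcC hx)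
    refine ⟨-j + 2 + k, x, hx, y, hy, hxi, hyi, ?_⟩
    have h3 : (b * a ^ i) * (b * a ^ (i + 2)) = a ^ (2 : ℤ) := by
      rw [zpow_add, ← mul_assoc b, ← mul_assoc, hinvol, one_mul]
    have h4 : (b * a ^ i) * a ^ j = (a ^ j)⁻¹ * (b * a ^ i) := by
      rw [← hainv i j]; group
    calc c * a ^ 2 = c * a ^ (2 : ℤ) := by norm_cast
      _ = c * (b * a ^ i) * (b * a ^ (i + 2)) := by rw [← h3, mul_assoc c]
      _ = (b * a ^ i) * a ^ j * ((c * x) * (b * a ^ (i + 2))) := by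
        rw [h1]; simp only [mul_assoc]
      _ = (a ^ j)⁻¹ * ((b * a ^ i) * (b * a ^ (i + 2))) * a ^ k * (c * (x * y)) := by
        rw [h2, h4]; simp only [mul_assoc]
      _ = _ := by rw [h3]; simp only [zpow_add, zpow_neg]
  obtain ⟨s, x₀, hx₀, y₀, hy₀, -, -, hs⟩ := hkey 0
  obtain ⟨ξ, hξ⟩ : ∃ ξ, ξ = x₀ * y₀ := ⟨_, rfl⟩
  have hξC : ξ ∈ Subgroup.zpowers c := hξ ▸ mul_mem hx₀ hy₀
  rw [← hξ] at hs
  have hcover (i : ℤ) : ∃ x ∈ Subgroup.zpowers c, ∃ y ∈ Subgroup.zpowers c,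
      (b * a ^ i) * x * (b * a ^ i)⁻¹ = x⁻¹ ∧
      (b * a ^ (i + 2)) * y * (b * a ^ (i + 2))⁻¹ = y⁻¹ ∧ ξ = x * y := by
    obtain ⟨r, x, hx, y, hy, hxi, hyi, hr⟩ := hkey i
    refine ⟨x, hx, y, hy, hxi, hyi, ?_⟩
    rw [hs] at hr
    have h1 : a ^ (-r) * a ^ s = c * (x * y) * (c * ξ)⁻¹ := by
      rw [eq_mul_inv_iff_mul_eq, mul_assoc, hr]; group
    have h2 := hDC (a ^ (-r) * a ^ s) (mul_mem (zpow_mem haD _) (zpow_mem haD _))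
      (h1 ▸ mul_mem (mul_mem hcC (mul_mem hx hy)) (inv_mem (mul_mem hcC hξC)))
    rw [h2, eq_comm, mul_inv_eq_one] at h1
    exact (mul_left_cancel h1).symm
  have hξ1 : ξ = 1 := by
    by_contra hne
    obtain ⟨p, hp, hpd⟩ := Nat.exists_prime_and_dvd (mt orderOf_eq_one_iff.1 hne)
    set z := ξ ^ (orderOf ξ / p) with hz
    have hzo : orderOf z = p := orderOf_pow_orderOf_div (orderOf_pos ξ).ne' hpd
    have hzC : z ∈ Subgroup.zpowers c := pow_mem hξC _
    have hor (i : ℤ) : (b * a ^ i) * z * (b * a ^ i)⁻¹ = z⁻¹ ∨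
        (b * a ^ (i + 2)) * z * (b * a ^ (i + 2))⁻¹ = z⁻¹ := by
      obtain ⟨x, hx, y, hy, hxi, hyi, hxy⟩ := hcover i
      have hcomm : Commute x y := by
        obtain ⟨k, rfl⟩ := Subgroup.mem_zpowers_iff.1 hx
        obtain ⟨l, rfl⟩ := Subgroup.mem_zpowers_iff.1 hy
        exact Commute.zpow_zpow_self c k l
      have : p ∣ orderOf x * orderOf y :=
        hpd.trans (hxy ▸ hcomm.orderOf_mul_dvd_mul_orderOf)
      rcases hp.dvd_mul.1 this with h | h
      · exact Or.inl (conj_eq_inv_of_mem_zpowers hxi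
          (mem_zpowers_of_orderOf_dvd hzC hx (hzo ▸ h)))
      · exact Or.inr (conj_eq_inv_of_mem_zpowers hyi
          (mem_zpowers_of_orderOf_dvd hzC hy (hzo ▸ h)))
    have hadj (i : ℤ) (h1 : (b * a ^ i) * z * (b * a ^ i)⁻¹ = z⁻¹)
        (h2 : (b * a ^ (i + 1)) * z * (b * a ^ (i + 1))⁻¹ = z⁻¹) : False := by
      have haz : a * z * a⁻¹ = z := by
        have h3 : (b * a ^ i) * (a * z * a⁻¹) * (b * a ^ i)⁻¹ =
            (b * a ^ i) * z * (b * a ^ i)⁻¹ := by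
          rw [h1, ← h2, zpow_add_one]; group
        exact mul_left_cancel (mul_right_cancel h3)
      have haiz : a ^ i * z * (a ^ i)⁻¹ = z := by
        have : Commute a z := by rwa [mul_inv_eq_iff_eq_mul] at haz
        rw [(this.zpow_left i).eq, mul_inv_cancel_right]
      have hbz : b * z * b⁻¹ = z⁻¹ := by
        rw [← h1]; conv_lhs => rw [← haiz]
        group
      have hcz : c * z * c⁻¹ = z := by
        obtain ⟨k, hk⟩ := Subgroup.mem_zpowers_iff.1 hzC
        rw [← hk]; group
      have hzN : (Subgroup.zpowers z).Normal :=
        hnormal z (by rw [haz]; exact Subgroup.mem_zpowers z)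
          (by rw [hbz]; exact inv_mem (Subgroup.mem_zpowers z))
          (by rw [hcz]; exact Subgroup.mem_zpowers z)
      have hle : Subgroup.zpowers z ≤ (Subgroup.zpowers c).normalCore :=
        Subgroup.normal_le_normalCore.2 (by simpa using hzC)
      rw [hcore, le_bot_iff, Subgroup.zpowers_eq_bot] at hle
      rw [hle, orderOf_one] at hzo
      exact hp.one_lt.ne hzo
    rcases hor 0 with h | h
    · rcases hor (-1) with h' | h'
      · exact hadj (-1) h' h
      · exact hadj 0 h h'
    · rcases hor 1 with h' | h'
      · exact hadj 1 h' h
      · exact hadj 2 h h'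
  have hconj : c * a ^ 2 * c⁻¹ = a ^ s := by
    rw [hs, hξ1]; group
  refine hnormal _ ?_ ?_ ?_
  · have : a * a ^ 2 * a⁻¹ = a ^ 2 := by group
    rw [this]; exact Subgroup.mem_zpowers _
  · rw [← conj_pow, hrel, inv_pow]; exact inv_mem (Subgroup.mem_zpowers _)
  · refine mem_zpowers_of_orderOf_dvd (g := a) (hconj ▸ ⟨s, rfl⟩)
      (pow_mem (Subgroup.mem_zpowers a) 2) (orderOf_dvd_of_pow_eq_one ?_)
    rw [conj_pow, pow_orderOf_eq_one, mul_one, mul_inv_cancel]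
end
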